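/- Let p ≥ 1, k ≥ 1, and let α_1, ..., α_{k+1} be complex numbers with Re(α_j) > p-1 for all j = 1, ..., k+1. Then ∫ ∏_{j=1}^k det(X_j)^{α_j - p} · det(I - X_1 - ... - X_k)^{α_{k+1} - p} dμ_p(X_1) ⋯ dμ_p(X_k) = ∏_{j=1}^{k+1} Γ̃_p(α_j) / Γ̃_p(α_1 + ... + α_{k+1}), where the integral is over all tuples (X_1, ..., X_k) of p×p complex self-adjoint matrices with each X_j positive definite and I - X_1 - ... - X_k positive definite. -/

import Mathlib

open MeasureTheory Matrix
open scoped ComplexOrder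

noncomputable section

/-- Parameter space `ℝ^p × ℂ^{p(p-1)/2}` for `p × p` Hermitian matrices:
the real diagonal entries together with the strictly upper-triangular complex entries. -/
abbrev HermParam (p : ℕ) : Type :=
  (Fin p → ℝ) × ({ q : Fin p × Fin p // q.1 < q.2 } → ℂ)

/-- The linear isomorphism sending the parameters to the corresponding self-adjoint matrix. -/
def toHermMatrix (p : ℕ) (T : HermParam p) : Matrix (Fin p) (Fin p) ℂ :=
  Matrix.of fun i j =>
    if h : i < j then T.2 ⟨(i, j), h⟩
    else if h' : j < i then (starRingEnd ℂ) (T.2 ⟨(j, i), h'⟩)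
    else (T.1 i : ℂ)

noncomputable instance matrixComplexMeasureSpace (m n : ℕ) :
    MeasureSpace (Matrix (Fin m) (Fin n) ℂ) :=
  inferInstanceAs (MeasureSpace (Fin m → Fin n → ℂ))

/-- The Lebesgue measure `μ_p` on Herm(p), realized as a measure on the space of
`p × p` complex matrices: the pushforward of Lebesgue measure on the parameter space
under the linear isomorphism `toHermMatrix p`. -/
def hermLebesgue (p : ℕ) : Measure (Matrix (Fin p) (Fin p) ℂ) :=
  Measure.map (toHermMatrix p) volume

/-- The complex matrix-variate gamma function
`Γ̃_p(α) = π^{p(p-1)/2} ∏_{j=1}^p Γ(α - j + 1) = π^{p(p-1)/2} ∏_{j=0}^{p-1} Γ(α - j)`. -/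
def cGammaP (p : ℕ) (α : ℂ) : ℂ :=
  (Real.pi : ℂ) ^ (p * (p - 1) / 2) * ∏ j : Fin p, Complex.Gamma (α - j)

end

section Instances

instance (p : ℕ) : BorelSpace (HermParam p) := Prod.borelSpace

instance (p k : ℕ) : BorelSpace (Fin k → HermParam p) := Pi.borelSpace

instance (p : ℕ) : MeasurableAdd (HermParam p) := inferInstance

instance (p : ℕ) : (volume : Measure (HermParam p)).IsAddHaarMeasure :=
  Measure.prod.instIsAddHaarMeasure _ _

instance (p : ℕ) : SigmaFinite (volume : Measure (HermParam p)) :=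
  inferInstanceAs (SigmaFinite (Measure.prod _ _))

instance (p k : ℕ) : (volume : Measure (Fin k → HermParam p)).IsAddHaarMeasure :=
  Measure.pi.isAddHaarMeasure _

end Instances

section CoordinateMaps

variable {p : ℕ}

/-- `toHermMatrix` as a real-linear map. -/
noncomputable def hermLin (p : ℕ) : HermParam p →ₗ[ℝ] Matrix (Fin p) (Fin p) ℂ where
  toFun := toHermMatrix p
  map_add' S T := by
    ext i j
    simp only [toHermMatrix, of_apply, Matrix.add_apply, Prod.fst_add, Prod.snd_add, Pi.add_apply]
    split_ifs <;> simp
  map_smul' c T := by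
    ext i j
    simp only [toHermMatrix, of_apply, Matrix.smul_apply, Prod.smul_fst, Prod.smul_snd,
      Pi.smul_apply]
    split_ifs <;> simp

/-- The coordinates of a self-adjoint matrix, extended linearly to all matrices. -/
noncomputable def hermCoord (p : ℕ) : Matrix (Fin p) (Fin p) ℂ →ₗ[ℝ] HermParam p where
  toFun N := (fun i => (N i i).re, fun q => N q.1.1 q.1.2)
  map_add' M N := by ext <;> simp
  map_smul' c N := by ext <;> simp

lemma hermLin_apply (T : HermParam p) : hermLin p T = toHermMatrix p T := rfl

lemma toHermMatrix_isHermitian (T : HermParam p) : (toHermMatrix p T).IsHermitian := by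
  ext i j
  simp only [conjTranspose_apply, toHermMatrix, of_apply]
  rcases lt_trichotomy i j with h | h | h
  · simp [h, h.not_gt]
  · simp [h]
  · simp [h, h.not_gt]

lemma toHermMatrix_hermCoord {N : Matrix (Fin p) (Fin p) ℂ} (hN : N.IsHermitian) :
    toHermMatrix p (hermCoord p N) = N := by
  ext i j
  simp only [hermCoord, LinearMap.coe_mk, AddHom.coe_mk, toHermMatrix, of_apply]
  rcases lt_trichotomy i j with h | h | h
  · simp [h]
  · subst h
    simpa using hN.coe_re_apply_self i
  · simpa [h, h.not_gt] using hN.apply i j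

lemma hermCoord_toHermMatrix (T : HermParam p) : hermCoord p (toHermMatrix p T) = T := by
  ext q
  · simp [hermCoord, toHermMatrix]
  · simp [hermCoord, toHermMatrix, q.2]

lemma toHermMatrix_add (S T : HermParam p) :
    toHermMatrix p (S + T) = toHermMatrix p S + toHermMatrix p T :=
  (hermLin p).map_add S T

lemma toHermMatrix_sub (S T : HermParam p) :
    toHermMatrix p (S - T) = toHermMatrix p S - toHermMatrix p T :=
  (hermLin p).map_sub S T

lemma toHermMatrix_sum {ι : Type*} (s : Finset ι) (T : ι → HermParam p) :
    toHermMatrix p (∑ i ∈ s, T i) = ∑ i ∈ s, toHermMatrix p (T i) :=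
  map_sum (hermLin p) T s

/-- The congruence `X ↦ A X Aᴴ` in coordinates. -/
noncomputable def hermCongr (A : Matrix (Fin p) (Fin p) ℂ) : HermParam p →ₗ[ℝ] HermParam p where
  toFun T := hermCoord p (A * toHermMatrix p T * Aᴴ)
  map_add' S T := by
    rw [toHermMatrix_add, mul_add, add_mul, map_add]
  map_smul' c T := by
    rw [← hermLin_apply, map_smul, Matrix.mul_smul, Matrix.smul_mul, map_smul]
    rfl

lemma toHermMatrix_hermCongr (A : Matrix (Fin p) (Fin p) ℂ) (T : HermParam p) :
    toHermMatrix p (hermCongr A T) = A * toHermMatrix p T * Aᴴ :=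
  toHermMatrix_hermCoord (isHermitian_mul_mul_conjTranspose A (toHermMatrix_isHermitian T))

lemma hermCongr_mul (A B : Matrix (Fin p) (Fin p) ℂ) :
    hermCongr (A * B) = hermCongr A ∘ₗ hermCongr B := by
  refine LinearMap.ext fun T => ?_
  rw [← hermCoord_toHermMatrix (hermCongr (A * B) T),
    ← hermCoord_toHermMatrix ((hermCongr A ∘ₗ hermCongr B) T)]
  simp only [LinearMap.comp_apply, toHermMatrix_hermCongr, conjTranspose_mul, mul_assoc]

lemma hermCongr_one : hermCongr (1 : Matrix (Fin p) (Fin p) ℂ) = LinearMap.id := by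
  refine LinearMap.ext fun T => ?_
  rw [← hermCoord_toHermMatrix (hermCongr 1 T), toHermMatrix_hermCongr]
  simp [hermCoord_toHermMatrix]

lemma prod_sq_mul_prod_lt_sq (d : Fin p → ℝ) :
    (∏ i, d i ^ 2) * ∏ q : { q : Fin p × Fin p // q.1 < q.2 }, (d q.1.1 * d q.1.2) ^ 2
      = (∏ i, d i ^ 2) ^ p := by
  have h1 : ∏ q : Fin p × Fin p, d q.1 * d q.2 = (∏ i, d i ^ 2) ^ p := by
    rw [Fintype.prod_prod_type]
    simp only [Finset.prod_mul_distrib, Finset.prod_const, Finset.card_univ, Fintype.card_fin,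
      Finset.prod_pow]
    ring
  have h2 : ∏ q : { q : Fin p × Fin p // q.1 < q.2 }, (d q.1.1 * d q.1.2)
      = ∏ i, ∏ j, if i < j then d i * d j else 1 := by
    rw [← Fintype.prod_prod_type' (fun i j => if i < j then d i * d j else 1), ← Finset.prod_filter,
      Finset.prod_subtype (p := fun q : Fin p × Fin p => q.1 < q.2) _ (by simp)
        (fun q => d q.1 * d q.2)]
  have h3 : ∏ i, ∏ j, (if i < j then d i * d j else 1)
      = ∏ i, ∏ j, if j < i then d i * d j else 1 := by
    rw [Finset.prod_comm]
    simp only [mul_comm]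
  have h4 : ∏ i, d i ^ 2 = ∏ i, ∏ j, if i = j then d i * d j else 1 := by
    simp [sq]
  rw [← h1, Finset.prod_pow Finset.univ 2 fun q : { q : Fin p × Fin p // q.1 < q.2 } => d q.1.1 * d q.1.2,
    sq (∏ q : { q : Fin p × Fin p // q.1 < q.2 }, d q.1.1 * d q.1.2), h2]
  nth_rw 2 [h3]
  rw [h4, Fintype.prod_prod_type]
  simp only [← Finset.prod_mul_distrib]
  refine Finset.prod_congr rfl fun i _ => Finset.prod_congr rfl fun j _ => ?_
  rcases lt_trichotomy i j with h | h | h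
  · simp [h, h.not_gt, h.ne]
  · simp [h]
  · simp [h, h.not_gt, h.ne']

lemma det_hermCongr_diagonal (d : Fin p → ℝ) :
    LinearMap.det (hermCongr (diagonal fun i => (d i : ℂ))) = (∏ i, d i ^ 2) ^ p := by
  have h : hermCongr (diagonal fun i => (d i : ℂ))
      = LinearMap.prodMap
        (LinearMap.pi fun i => ((d i ^ 2) • LinearMap.id) ∘ₗ LinearMap.proj i)
        (LinearMap.pi fun q : { q : Fin p × Fin p // q.1 < q.2 } =>
          ((d q.1.1 * d q.1.2) • LinearMap.id) ∘ₗ LinearMap.proj q) := by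
    refine LinearMap.ext fun T => Prod.ext (funext fun i => ?_) (funext fun q => ?_)
    · simp [hermCongr, hermCoord, diagonal_conjTranspose, toHermMatrix]
      ring
    · simp [hermCongr, hermCoord, diagonal_conjTranspose, toHermMatrix, q.2]
      ring
  rw [h, LinearMap.det_prodMap, LinearMap.det_pi, LinearMap.det_pi, ← prod_sq_mul_prod_lt_sq]
  simp [LinearMap.det_smul]

lemma exists_eq_mul_conjTranspose {S : Matrix (Fin p) (Fin p) ℂ} (hS : S.PosDef) :
    ∃ A : Matrix (Fin p) (Fin p) ℂ, IsUnit A ∧ S = A * Aᴴ ∧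
      LinearMap.det (hermCongr A) = S.det.re ^ p := by
  set U : Matrix (Fin p) (Fin p) ℂ :=
    (hS.isHermitian.eigenvectorUnitary : Matrix (Fin p) (Fin p) ℂ) with hU
  set ev := hS.isHermitian.eigenvalues with hev
  have hpos : ∀ i, 0 < ev i := hS.eigenvalues_pos
  have hUU : U * Uᴴ = 1 := Unitary.mul_star_self_of_mem hS.isHermitian.eigenvectorUnitary.2
  have hUU' : Uᴴ * U = 1 := Unitary.star_mul_self_of_mem hS.isHermitian.eigenvectorUnitary.2
  set D : Matrix (Fin p) (Fin p) ℂ := diagonal fun i => ((√(ev i) : ℝ) : ℂ) with hD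
  have hDD : D * Dᴴ = diagonal fun i => (ev i : ℂ) := by
    rw [hD, diagonal_conjTranspose, diagonal_mul_diagonal]
    congr 1
    ext i
    simp [← Complex.ofReal_mul, Real.mul_self_sqrt (hpos i).le]
  have hSA : S = (U * D * Uᴴ) * (U * D * Uᴴ)ᴴ := by
    have : (U * D * Uᴴ) * (U * D * Uᴴ)ᴴ = U * (D * Dᴴ) * Uᴴ := by
      simp only [conjTranspose_mul, conjTranspose_conjTranspose, mul_assoc]
      rw [← mul_assoc Uᴴ U, hUU', one_mul]
    rw [this, hDD]
    exact hS.isHermitian.spectral_theorem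
  refine ⟨U * D * Uᴴ, ?_, hSA, ?_⟩
  · have := hS.isUnit
    rw [hSA] at this
    exact isUnit_of_mul_isUnit_left this
  · rw [hermCongr_mul, hermCongr_mul, LinearMap.det_comp, LinearMap.det_comp,
      mul_right_comm, ← LinearMap.det_comp, ← hermCongr_mul, hUU, hermCongr_one, LinearMap.det_id,
      one_mul, det_hermCongr_diagonal, hS.isHermitian.det_eq_prod_eigenvalues]
    simp only [Real.sq_sqrt (hpos _).le]
    congr 1
    rw [← Complex.ofReal_re (∏ i, ev i)]
    simp [hev]

end CoordinateMaps

section ConePowers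

variable {p : ℕ}

lemma continuous_toHermMatrix : Continuous (toHermMatrix p) :=
  (hermLin p).continuous_of_finiteDimensional

lemma measurableSet_posDef : MeasurableSet {T : HermParam p | (toHermMatrix p T).PosDef} := by
  have h : {T : HermParam p | (toHermMatrix p T).PosDef}
      = {T | ∀ x : Fin p → ℂ, 0 ≤ star x ⬝ᵥ (toHermMatrix p T *ᵥ x)}
        ∩ {T | (toHermMatrix p T).det = 0}ᶜ := by
    ext T
    simp only [Set.mem_ofPred_eq, Set.mem_inter_iff, Set.mem_compl_iff]
    constructor
    · intro hT
      exact ⟨hT.posSemidef.dotProduct_mulVec_nonneg, hT.det_pos.ne'⟩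
    · rintro ⟨h1, h2⟩
      rw [(PosSemidef.of_dotProduct_mulVec_nonneg (toHermMatrix_isHermitian T) h1).posDef_iff_isUnit,
        isUnit_iff_isUnit_det]
      exact isUnit_iff_ne_zero.mpr h2
  rw [h]
  refine MeasurableSet.inter ?_ (MeasurableSet.compl ?_)
  · rw [Set.ofPred_forall]
    refine (isClosed_iInter fun x => isClosed_le continuous_const ?_).measurableSet
    exact continuous_const.dotProduct (continuous_toHermMatrix.matrix_mulVec continuous_const)
  · exact (isClosed_eq continuous_toHermMatrix.matrix_det continuous_const).measurableSet

open Classical in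
/-- The power `det(X)^s` on the positive definite cone, extended by zero. -/
noncomputable def hermPow (p : ℕ) (s : ℂ) (T : HermParam p) : ℂ :=
  if (toHermMatrix p T).PosDef then ((toHermMatrix p T).det.re : ℂ) ^ s else 0

lemma hermPow_of_posDef {s : ℂ} {T : HermParam p} (h : (toHermMatrix p T).PosDef) :
    hermPow p s T = ((toHermMatrix p T).det.re : ℂ) ^ s := if_pos h

lemma hermPow_of_not_posDef {s : ℂ} {T : HermParam p} (h : ¬(toHermMatrix p T).PosDef) :
    hermPow p s T = 0 := if_neg h

lemma measurable_hermPow (s : ℂ) : Measurable (hermPow p s) := by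
  refine Measurable.ite measurableSet_posDef (Measurable.pow_const ?_ s) measurable_const
  exact (Complex.continuous_ofReal.comp
    (Complex.continuous_re.comp continuous_toHermMatrix.matrix_det)).measurable

lemma posDef_det_re_pos {S : Matrix (Fin p) (Fin p) ℂ} (hS : S.PosDef) : 0 < S.det.re :=
  (Complex.pos_iff.mp hS.det_pos).1

lemma hermPow_hermCongr {A : Matrix (Fin p) (Fin p) ℂ} (hA : IsUnit A) (s : ℂ) (T : HermParam p) :
    hermPow p s (hermCongr A T) = ((A * Aᴴ).det.re : ℂ) ^ s * hermPow p s T := by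
  have hiff : (toHermMatrix p (hermCongr A T)).PosDef ↔ (toHermMatrix p T).PosDef := by
    rw [toHermMatrix_hermCongr]
    exact IsUnit.posDef_star_right_conjugate_iff hA
  by_cases h : (toHermMatrix p T).PosDef
  · rw [hermPow_of_posDef h, hermPow_of_posDef (hiff.mpr h), toHermMatrix_hermCongr]
    have h1 : 0 ≤ (A * Aᴴ).det := (posSemidef_self_mul_conjTranspose A).det_nonneg
    have h2 : (A * toHermMatrix p T * Aᴴ).det = (A * Aᴴ).det * (toHermMatrix p T).det := by
      simp only [det_mul]
      ring
    have h3 := (Complex.nonneg_iff.mp h1)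
    rw [h2, Complex.mul_re, ← h3.2, zero_mul, sub_zero, Complex.ofReal_mul,
      Complex.mul_cpow_ofReal_nonneg h3.1 (posDef_det_re_pos h).le]
  · rw [hermPow_of_not_posDef h, hermPow_of_not_posDef (mt hiff.mp h), mul_zero]

lemma integral_comp_linearMap {E : Type*} [NormedAddCommGroup E] [NormedSpace ℝ E]
    [FiniteDimensional ℝ E] [MeasurableSpace E] [BorelSpace E] (μ : Measure E)
    [μ.IsAddHaarMeasure] {L : E →ₗ[ℝ] E} (hL : LinearMap.det L ≠ 0) (f : E → ℂ) :
    ∫ x, f x ∂μ = ((|LinearMap.det L| : ℝ) : ℂ) * ∫ x, f (L x) ∂μ := by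
  have hemb : MeasurableEmbedding L :=
    (LinearMap.isClosedEmbedding_of_injective
      (LinearMap.equivOfDetNeZero L hL).ker).measurableEmbedding
  rw [← hemb.integral_map, Measure.map_linearMap_addHaar_eq_smul_addHaar μ hL,
    integral_smul_measure, ENNReal.toReal_ofReal (abs_nonneg _), Complex.real_smul, ← mul_assoc,
    ← Complex.ofReal_mul, ← abs_mul, mul_inv_cancel₀ hL]
  simp

/-- The Dirichlet integral over tuples of positive definite matrices whose sum is below `S`. -/
noncomputable def dirichletIntegral (p k : ℕ) (s : Fin (k + 1) → ℂ) (S : HermParam p) : ℂ :=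
  ∫ X : Fin k → HermParam p,
    (∏ j : Fin k, hermPow p (s j.castSucc) (X j)) * hermPow p (s (Fin.last k)) (S - ∑ j, X j)

lemma cpow_sum {ι : Type*} (t : Finset ι) (f : ι → ℂ) {c : ℂ} (hc : c ≠ 0) :
    c ^ (∑ i ∈ t, f i) = ∏ i ∈ t, c ^ f i := by
  classical
  induction t using Finset.induction_on with
  | empty => simp
  | insert a t ha ih => rw [Finset.sum_insert ha, Finset.prod_insert ha, Complex.cpow_add _ _ hc, ih]

lemma dirichletIntegral_of_posDef (k : ℕ) (s : Fin (k + 1) → ℂ) {S : HermParam p}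
    (hS : (toHermMatrix p S).PosDef) :
    dirichletIntegral p k s S = ((toHermMatrix p S).det.re : ℂ) ^ (∑ j, s j + k * p)
      * dirichletIntegral p k s (hermCoord p 1) := by
  obtain ⟨A, hA, hSA, hdet⟩ := exists_eq_mul_conjTranspose hS
  set c := (toHermMatrix p S).det.re with hc
  have hcpos : 0 < c := posDef_det_re_pos hS
  have hc0 : (c : ℂ) ≠ 0 := Complex.ofReal_ne_zero.mpr hcpos.ne'
  have hS1 : S = hermCongr A (hermCoord p 1) := by
    rw [← hermCoord_toHermMatrix (hermCongr A _), toHermMatrix_hermCongr,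
      toHermMatrix_hermCoord isHermitian_one, mul_one, ← hSA, hermCoord_toHermMatrix]
  have hL : LinearMap.det (LinearMap.pi fun i : Fin k => hermCongr A ∘ₗ LinearMap.proj i)
      = c ^ (p * k) := by
    rw [LinearMap.det_pi, hdet]
    simp [pow_mul]
  rw [dirichletIntegral, integral_comp_linearMap volume (hL.trans_ne (pow_pos hcpos _).ne'), hL,
    dirichletIntegral, ← integral_const_mul, ← integral_const_mul]
  congr 1
  ext X
  have h1 : S - ∑ j, (LinearMap.pi fun i : Fin k => hermCongr A ∘ₗ LinearMap.proj i) X j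
      = hermCongr A (hermCoord p 1 - ∑ j, X j) := by
    rw [map_sub, map_sum, ← hS1]
    rfl
  rw [h1]
  simp only [LinearMap.pi_apply, LinearMap.comp_apply, LinearMap.proj_apply, hermPow_hermCongr hA,
    ← hSA, ← hc, Finset.prod_mul_distrib, abs_of_pos (pow_pos hcpos _)]
  rw [Complex.cpow_add _ _ hc0, Fin.sum_univ_castSucc, Complex.cpow_add _ _ hc0,
    cpow_sum _ _ hc0, ← Nat.cast_mul, Complex.cpow_natCast, mul_comm k p]
  push_cast
  ring

lemma dirichletIntegral_of_not_posDef (k : ℕ) (s : Fin (k + 1) → ℂ) {S : HermParam p}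
    (hS : ¬(toHermMatrix p S).PosDef) : dirichletIntegral p k s S = 0 := by
  rw [dirichletIntegral]
  refine integral_eq_zero_of_ae (Filter.Eventually.of_forall fun X => ?_)
  by_contra hne
  rw [Pi.zero_apply, mul_eq_zero, not_or, Finset.prod_eq_zero_iff] at hne
  have h1 : ∀ j, (toHermMatrix p (X j)).PosDef := fun j => by
    by_contra h
    exact hne.1 ⟨j, Finset.mem_univ j, hermPow_of_not_posDef h⟩
  have h2 : (toHermMatrix p (S - ∑ j, X j)).PosDef := by
    by_contra h
    exact hne.2 (hermPow_of_not_posDef h)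
  have h3 : (toHermMatrix p (∑ j, X j)).PosSemidef := by
    rw [toHermMatrix_sum]
    exact posSemidef_sum _ fun j _ => (h1 j).posSemidef
  apply hS
  have := h2.add_posSemidef h3
  rwa [← toHermMatrix_add, sub_add_cancel] at this

lemma dirichletIntegral_eq (k : ℕ) (s : Fin (k + 1) → ℂ) (S : HermParam p) :
    dirichletIntegral p k s S
      = hermPow p (∑ j, s j + k * p) S * dirichletIntegral p k s (hermCoord p 1) := by
  by_cases hS : (toHermMatrix p S).PosDef
  · rw [dirichletIntegral_of_posDef k s hS, hermPow_of_posDef hS]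
  · rw [dirichletIntegral_of_not_posDef k s hS, hermPow_of_not_posDef hS, zero_mul]

/-- The integrand of the matrix-variate gamma integral. -/
noncomputable def hermGammaIntegrand (p : ℕ) (α : ℂ) (T : HermParam p) : ℂ :=
  hermPow p (α - p) T * Complex.exp (-∑ i, (T.1 i : ℂ))

lemma measurable_hermGammaIntegrand (α : ℂ) : Measurable (hermGammaIntegrand p α) := by
  refine (measurable_hermPow _).mul (Continuous.measurable ?_)
  fun_prop

end ConePowers

section Gluing

variable {p : ℕ}

/-- The strictly upper-triangular positions of a matrix of size `p + 1` are those of the first row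
together with those of the lower right block. -/
noncomputable def upperIndexEquiv (p : ℕ) : Fin p ⊕ { q : Fin p × Fin p // q.1 < q.2 } ≃
    { q : Fin (p + 1) × Fin (p + 1) // q.1 < q.2 } :=
  Equiv.ofBijective
    (Sum.elim (fun i => ⟨(0, i.succ), i.succ_pos⟩)
      fun q => ⟨(q.1.1.succ, q.1.2.succ), Fin.succ_lt_succ_iff.mpr q.2⟩) <| by
    constructor
    · rintro (i | ⟨⟨i, j⟩, h⟩) (i' | ⟨⟨i', j'⟩, h'⟩) hij
      · simpa using hij
      · simp [(Fin.succ_ne_zero _).symm] at hij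
      · simp at hij
      · simpa using hij
    · rintro ⟨⟨i, j⟩, h⟩
      obtain ⟨j, rfl⟩ := Fin.exists_succ_eq.mpr (Fin.ne_zero_of_lt h)
      refine Fin.cases (fun h => ?_) (fun i h => ?_) i h
      · exact ⟨Sum.inl j, rfl⟩
      · exact ⟨Sum.inr ⟨(i, j), Fin.succ_lt_succ_iff.mp h⟩, rfl⟩

/-- Assemble a self-adjoint matrix of size `p + 1` from its corner entry, the rest of its first row
and its lower right block. -/
noncomputable def hermGlue (p : ℕ) (z : (ℝ × (Fin p → ℂ)) × HermParam p) : HermParam (p + 1) :=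
  (Fin.cons z.1.1 z.2.1, fun q => Sum.elim z.1.2 z.2.2 ((upperIndexEquiv p).symm q))

lemma toHermMatrix_hermGlue_zero_zero (z : (ℝ × (Fin p → ℂ)) × HermParam p) :
    toHermMatrix (p + 1) (hermGlue p z) 0 0 = z.1.1 := by
  simp [toHermMatrix, hermGlue]

lemma hermGlue_snd_zero_succ (z : (ℝ × (Fin p → ℂ)) × HermParam p) (j : Fin p) :
    (hermGlue p z).2 ⟨(0, j.succ), j.succ_pos⟩ = z.1.2 j := by
  change Sum.elim z.1.2 z.2.2 ((upperIndexEquiv p).symm (upperIndexEquiv p (Sum.inl j))) = _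
  rw [Equiv.symm_apply_apply, Sum.elim_inl]

lemma hermGlue_snd_succ_succ (z : (ℝ × (Fin p → ℂ)) × HermParam p) {i j : Fin p} (h : i < j) :
    (hermGlue p z).2 ⟨(i.succ, j.succ), Fin.succ_lt_succ_iff.mpr h⟩ = z.2.2 ⟨(i, j), h⟩ := by
  change Sum.elim z.1.2 z.2.2
    ((upperIndexEquiv p).symm (upperIndexEquiv p (Sum.inr ⟨(i, j), h⟩))) = _
  rw [Equiv.symm_apply_apply, Sum.elim_inr]

lemma toHermMatrix_hermGlue_zero_succ (z : (ℝ × (Fin p → ℂ)) × HermParam p) (j : Fin p) :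
    toHermMatrix (p + 1) (hermGlue p z) 0 j.succ = z.1.2 j := by
  rw [← hermGlue_snd_zero_succ z j]
  simp [toHermMatrix, j.succ_pos]

lemma toHermMatrix_hermGlue_succ_zero (z : (ℝ × (Fin p → ℂ)) × HermParam p) (j : Fin p) :
    toHermMatrix (p + 1) (hermGlue p z) j.succ 0 = star (z.1.2 j) := by
  rw [← (toHermMatrix_isHermitian _).apply, toHermMatrix_hermGlue_zero_succ]

lemma toHermMatrix_hermGlue_succ_succ (z : (ℝ × (Fin p → ℂ)) × HermParam p) (i j : Fin p) :
    toHermMatrix (p + 1) (hermGlue p z) i.succ j.succ = toHermMatrix p z.2 i j := by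
  rcases lt_trichotomy i j with h | h | h
  · simp [toHermMatrix, h, hermGlue_snd_succ_succ]
  · simp [toHermMatrix, h, hermGlue]
  · simp [toHermMatrix, h, h.not_gt, hermGlue_snd_succ_succ]

lemma measurePreserving_prodProdProdComm {A B C D : Type*} [MeasureSpace A] [MeasureSpace B]
    [MeasureSpace C] [MeasureSpace D] [SigmaFinite (volume : Measure A)]
    [SigmaFinite (volume : Measure B)] [SigmaFinite (volume : Measure C)]
    [SigmaFinite (volume : Measure D)] :
    MeasurePreserving (fun z : (A × B) × (C × D) => ((z.1.1, z.2.1), (z.1.2, z.2.2)))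
      ((volume.prod volume).prod (volume.prod volume))
      ((volume.prod volume).prod (volume.prod volume)) := by
  have h1 := measurePreserving_prodAssoc (volume : Measure A) (volume : Measure B)
    ((volume : Measure C).prod (volume : Measure D))
  have h2 := (measurePreserving_prodAssoc (volume : Measure B) (volume : Measure C)
    (volume : Measure D)).symm
  have h3 := (Measure.measurePreserving_swap (μ := (volume : Measure B))
    (ν := (volume : Measure C))).prod (MeasurePreserving.id (volume : Measure D))
  have h4 := measurePreserving_prodAssoc (volume : Measure C) (volume : Measure B)
    (volume : Measure D)
  have h5 := (measurePreserving_prodAssoc (volume : Measure A) (volume : Measure C)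
    ((volume : Measure B).prod (volume : Measure D))).symm
  exact h5.comp (((MeasurePreserving.id volume).prod (h4.comp (h3.comp h2))).comp h1)

lemma measurePreserving_hermGlue :
    MeasurePreserving (hermGlue p) ((volume.prod volume).prod volume) volume := by
  have h1 : MeasurePreserving (fun z : ℝ × (Fin p → ℝ) => (Fin.cons z.1 z.2 : Fin (p + 1) → ℝ))
      (volume.prod volume) volume := by
    have h := (volume_preserving_piFinSuccAbove (fun _ : Fin (p + 1) => ℝ) 0).symm
    have heq : ⇑(MeasurableEquiv.piFinSuccAbove (fun _ : Fin (p + 1) => ℝ) 0).symm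
        = fun z : ℝ × (Fin p → ℝ) => (Fin.cons z.1 z.2 : Fin (p + 1) → ℝ) :=
      funext fun z => Fin.insertNth_zero' z.1 z.2
    rwa [heq] at h
  have h2 : MeasurePreserving (fun (z : (Fin p → ℂ) × ({ q : Fin p × Fin p // q.1 < q.2 } → ℂ)) q =>
      Sum.elim z.1 z.2 ((upperIndexEquiv p).symm q)) (volume.prod volume) volume := by
    have h := (volume_measurePreserving_piCongrLeft (fun _ => ℂ) (upperIndexEquiv p)).comp
      (volume_measurePreserving_sumPiEquivProdPi
        (fun _ : Fin p ⊕ { q : Fin p × Fin p // q.1 < q.2 } => ℂ)).symm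
    have heq : ⇑(MeasurableEquiv.piCongrLeft (fun _ => ℂ) (upperIndexEquiv p)) ∘
        ⇑(MeasurableEquiv.sumPiEquivProdPi
          (fun _ : Fin p ⊕ { q : Fin p × Fin p // q.1 < q.2 } => ℂ)).symm
        = fun z q => Sum.elim z.1 z.2 ((upperIndexEquiv p).symm q) := by
      funext z q
      obtain ⟨a, rfl⟩ := (upperIndexEquiv p).surjective q
      simp only [Equiv.symm_apply_apply, Function.comp_apply, MeasurableEquiv.coe_piCongrLeft,
        Equiv.piCongrLeft_apply_apply]
      cases a <;> rfl
    rwa [heq] at h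
  exact (h1.prod h2).comp measurePreserving_prodProdProdComm

/-- The rank-one self-adjoint matrix `vᴴ v / x` of a row vector `v`, in coordinates. -/
noncomputable def rankOneHerm (p : ℕ) (y : ℝ × (Fin p → ℂ)) : HermParam p :=
  (fun i => y.1⁻¹ * ‖y.2 i‖ ^ 2, fun q => (y.1 : ℂ)⁻¹ * (star (y.2 q.1.1) * y.2 q.1.2))

lemma toHermMatrix_rankOneHerm (y : ℝ × (Fin p → ℂ)) (i j : Fin p) :
    toHermMatrix p (rankOneHerm p y) i j = (y.1 : ℂ)⁻¹ * (star (y.2 i) * y.2 j) := by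
  rcases lt_trichotomy i j with h | h | h
  · simp [toHermMatrix, rankOneHerm, h]
  · simp [toHermMatrix, rankOneHerm, h, Complex.conj_mul']
  · simp [toHermMatrix, rankOneHerm, h, h.not_gt, mul_comm]

lemma measurable_rankOneHerm : Measurable (rankOneHerm p) := by
  unfold rankOneHerm
  fun_prop

/-- Assemble a self-adjoint matrix of size `p + 1` from its corner entry, the rest of its first row
and the Schur complement of the corner. -/
noncomputable def schurGlue (p : ℕ) (z : (ℝ × (Fin p → ℂ)) × HermParam p) : HermParam (p + 1) :=
  hermGlue p (z.1, z.2 + rankOneHerm p z.1)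

lemma measurePreserving_schurGlue :
    MeasurePreserving (schurGlue p) ((volume.prod volume).prod volume) volume := by
  refine measurePreserving_hermGlue.comp
    ((MeasurePreserving.id _).skew_product (g := fun y Z => Z + rankOneHerm p y) ?_ ?_)
  · exact measurable_snd.add (measurable_rankOneHerm.comp measurable_fst)
  · exact Filter.Eventually.of_forall fun y => map_add_right_eq_self volume _

lemma posDef_schurGlue_iff_and_det {x : ℝ} (hx : 0 < x) (v : Fin p → ℂ) (Z : HermParam p) :
    ((toHermMatrix (p + 1) (schurGlue p ((x, v), Z))).PosDef ↔ (toHermMatrix p Z).PosDef) ∧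
      (toHermMatrix (p + 1) (schurGlue p ((x, v), Z))).det = x * (toHermMatrix p Z).det := by
  set N := toHermMatrix (p + 1) (schurGlue p ((x, v), Z)) with hN
  have hx0 : (x : ℂ) ≠ 0 := Complex.ofReal_ne_zero.mpr hx.ne'
  let e : Unit ⊕ Fin p ≃ Fin (p + 1) :=
    Equiv.ofBijective (Sum.elim (fun _ => 0) Fin.succ) <| by
      constructor
      · rintro (_ | i) (_ | j) h
        · rfl
        · exact absurd h (Fin.succ_ne_zero _).symm
        · exact absurd h (Fin.succ_ne_zero _)
        · exact congrArg Sum.inr (Fin.succ_injective _ h)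
      · exact Fin.cases ⟨Sum.inl (), rfl⟩ fun i => ⟨Sum.inr i, rfl⟩
  let A : Matrix Unit Unit ℂ := diagonal fun _ => (x : ℂ)
  let B : Matrix Unit (Fin p) ℂ := of fun _ j => v j
  have hA : A.PosDef := PosDef.diagonal fun _ => Complex.zero_lt_real.mpr hx
  have hAinv : A⁻¹ = diagonal fun _ => (x : ℂ)⁻¹ :=
    inv_eq_right_inv (by simp [A, diagonal_mul_diagonal, hx0])
  let : Invertible A := hA.isUnit.invertible
  have hblock : N.submatrix e e
      = fromBlocks A B Bᴴ (toHermMatrix p Z + Bᴴ * A⁻¹ * B) := by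
    ext (i | i) (j | j)
    · exact toHermMatrix_hermGlue_zero_zero _
    · exact toHermMatrix_hermGlue_zero_succ _ j
    · exact toHermMatrix_hermGlue_succ_zero _ i
    · refine (toHermMatrix_hermGlue_succ_succ _ i j).trans ?_
      rw [toHermMatrix_add, Matrix.add_apply, toHermMatrix_rankOneHerm, hAinv]
      simp [Matrix.mul_apply, B]
      ring
  have hdet : N.det = x * (toHermMatrix p Z).det := by
    rw [← det_submatrix_equiv_self e N, hblock, det_fromBlocks₁₁, invOf_eq_nonsing_inv,
      add_sub_cancel_right]
    simp [A]
  refine ⟨?_, hdet⟩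
  have hpsd : N.PosSemidef ↔ (toHermMatrix p Z).PosSemidef := by
    rw [← posSemidef_submatrix_equiv e, hblock, PosDef.fromBlocks₁₁ _ _ hA, add_sub_cancel_right]
  have hunit : IsUnit N ↔ IsUnit (toHermMatrix p Z) := by
    simp only [isUnit_iff_isUnit_det, hdet, isUnit_iff_ne_zero, mul_ne_zero_iff, ne_eq, hx0,
      not_false_eq_true, true_and]
  constructor
  · intro h
    exact (hpsd.mp h.posSemidef).posDef_iff_isUnit.mpr (hunit.mp h.isUnit)
  · intro h
    exact (hpsd.mpr h.posSemidef).posDef_iff_isUnit.mpr (hunit.mpr h.isUnit)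

lemma hermPow_schurGlue (s : ℂ) (z : (ℝ × (Fin p → ℂ)) × HermParam p) :
    hermPow (p + 1) s (schurGlue p z)
      = (if 0 < z.1.1 then (z.1.1 : ℂ) ^ s else 0) * hermPow p s z.2 := by
  obtain ⟨⟨x, v⟩, Z⟩ := z
  by_cases hx : 0 < x
  · obtain ⟨hiff, hdet⟩ := posDef_schurGlue_iff_and_det hx v Z
    by_cases hZ : (toHermMatrix p Z).PosDef
    · rw [hermPow_of_posDef hZ, hermPow_of_posDef (hiff.mpr hZ), hdet, Complex.re_ofReal_mul,
        Complex.ofReal_mul, Complex.mul_cpow_ofReal_nonneg hx.le (posDef_det_re_pos hZ).le,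
        if_pos hx]
    · rw [hermPow_of_not_posDef hZ, hermPow_of_not_posDef (mt hiff.mp hZ), mul_zero]
  · rw [if_neg hx, zero_mul]
    refine hermPow_of_not_posDef fun h => hx ?_
    have h0 : 0 < toHermMatrix (p + 1) (schurGlue p ((x, v), Z)) 0 0 := h.diag_pos
    rw [schurGlue, toHermMatrix_hermGlue_zero_zero] at h0
    exact Complex.zero_lt_real.mp h0

end Gluing

section GammaIntegral

variable {p : ℕ}

/-- The contribution of the first row to the matrix-variate gamma integrand of size `p + 1`. -/
noncomputable def rowGammaIntegrand (p : ℕ) (α : ℂ) (y : ℝ × (Fin p → ℂ)) : ℂ :=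
  (if 0 < y.1 then (y.1 : ℂ) ^ (α - (p + 1)) * Real.exp (-y.1) else 0)
    * ((∏ i, Real.exp (-y.1⁻¹ * ‖y.2 i‖ ^ 2) : ℝ) : ℂ)

lemma hermGammaIntegrand_schurGlue (α : ℂ) (z : (ℝ × (Fin p → ℂ)) × HermParam p) :
    hermGammaIntegrand (p + 1) α (schurGlue p z)
      = rowGammaIntegrand p α z.1 * hermGammaIntegrand p (α - 1) z.2 := by
  have h1 : ∑ i, ((schurGlue p z).1 i : ℂ)
      = z.1.1 + (∑ i, (z.2.1 i : ℂ) + ∑ i, ((z.1.1⁻¹ * ‖z.1.2 i‖ ^ 2 : ℝ) : ℂ)) := by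
    rw [Fin.sum_univ_succ, ← Finset.sum_add_distrib]
    simp [schurGlue, hermGlue, rankOneHerm]
  have h2 : (((∏ i, Real.exp (-z.1.1⁻¹ * ‖z.1.2 i‖ ^ 2) : ℝ)) : ℂ)
      = Complex.exp (-∑ i, ((z.1.1⁻¹ * ‖z.1.2 i‖ ^ 2 : ℝ) : ℂ)) := by
    rw [← Real.exp_sum]
    simp [Finset.sum_neg_distrib]
  have h3 : α - 1 - p = α - (p + 1) := by ring
  rw [hermGammaIntegrand, hermGammaIntegrand, rowGammaIntegrand, hermPow_schurGlue, h1, h2, h3,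
    neg_add, neg_add, Complex.exp_add, Complex.exp_add, Nat.cast_succ]
  split_ifs
  · push_cast
    ring
  · simp

lemma integral_prod_exp_neg_mul_norm_sq {b : ℝ} (hb : 0 < b) :
    ∫ v : Fin p → ℂ, ∏ i, Real.exp (-b * ‖v i‖ ^ 2) = (Real.pi / b) ^ p := by
  rw [volume_pi, integral_fintype_prod_eq_prod (fun (_ : Fin p) (z : ℂ) => Real.exp (-b * ‖z‖ ^ 2))]
  simp only [GaussianFourier.integral_rexp_neg_mul_sq_norm (V := ℂ) hb]
  simp [div_pow]

lemma integrable_prod_exp_neg_mul_norm_sq {b : ℝ} (hb : 0 < b) :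
    Integrable fun v : Fin p → ℂ => ∏ i, Real.exp (-b * ‖v i‖ ^ 2) := by
  refine Integrable.of_integral_ne_zero ?_
  rw [integral_prod_exp_neg_mul_norm_sq hb]
  have := Real.pi_pos
  positivity

lemma measurable_rowGammaIntegrand (α : ℂ) : Measurable (rowGammaIntegrand p α) := by
  refine Measurable.mul (Measurable.ite (measurableSet_lt measurable_const measurable_fst) ?_
    measurable_const) ?_ <;> fun_prop

lemma integral_norm_rowGammaIntegrand (α : ℂ) (x : ℝ) :
    ∫ v, ‖rowGammaIntegrand p α (x, v)‖ = (Set.Ioi 0).indicator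
      (fun x => Real.pi ^ p * (Real.exp (-x) * x ^ (α.re - 1))) x := by
  by_cases hx : 0 < x
  · have h1 : ∀ v : Fin p → ℂ, ‖rowGammaIntegrand p α (x, v)‖
        = (x ^ (α.re - (p + 1)) * Real.exp (-x)) * ∏ i, Real.exp (-x⁻¹ * ‖v i‖ ^ 2) := fun v => by
      rw [rowGammaIntegrand, if_pos hx, norm_mul, norm_mul, Complex.norm_cpow_eq_rpow_re_of_pos hx,
        Complex.norm_of_nonneg (Real.exp_pos _).le,
        Complex.norm_of_nonneg (Finset.prod_nonneg fun _ _ => (Real.exp_pos _).le)]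
      simp
    simp only [h1]
    rw [integral_const_mul, integral_prod_exp_neg_mul_norm_sq (inv_pos.mpr hx),
      Set.indicator_of_mem (Set.mem_Ioi.mpr hx), div_inv_eq_mul, mul_pow,
      show α.re - 1 = α.re - (p + 1) + p by ring, Real.rpow_add hx, Real.rpow_natCast]
    ring
  · simp [rowGammaIntegrand, hx]

lemma integral_rowGammaIntegrand_row (α : ℂ) (x : ℝ) :
    ∫ v, rowGammaIntegrand p α (x, v) = (Set.Ioi 0).indicator
      (fun x : ℝ => (Real.pi : ℂ) ^ p * (Real.exp (-x) * (x : ℂ) ^ (α - 1))) x := by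
  by_cases hx : 0 < x
  · simp only [rowGammaIntegrand, if_pos hx]
    have hx0 : (x : ℂ) ≠ 0 := Complex.ofReal_ne_zero.mpr hx.ne'
    rw [integral_const_mul, integral_complex_ofReal,
      integral_prod_exp_neg_mul_norm_sq (inv_pos.mpr hx),
      Set.indicator_of_mem (Set.mem_Ioi.mpr hx), div_inv_eq_mul, mul_pow,
      show α - 1 = α - (p + 1) + p by ring, Complex.cpow_add _ _ hx0, Complex.cpow_natCast]
    push_cast
    ring
  · simp [rowGammaIntegrand, hx]

lemma integrable_rowGammaIntegrand {α : ℂ} (hα : 0 < α.re) :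
    Integrable (rowGammaIntegrand p α) (volume.prod volume) := by
  rw [integrable_prod_iff (measurable_rowGammaIntegrand α).aestronglyMeasurable]
  constructor
  · refine Filter.Eventually.of_forall fun x => ?_
    by_cases hx : 0 < x
    · simp only [rowGammaIntegrand]
      exact (integrable_prod_exp_neg_mul_norm_sq (inv_pos.mpr hx)).ofReal.const_mul (𝕜 := ℂ) _
    · simp [rowGammaIntegrand, hx]
  · simp only [integral_norm_rowGammaIntegrand]
    exact (integrable_indicator_iff measurableSet_Ioi).mpr
      ((Real.GammaIntegral_convergent hα).const_mul _)

lemma integral_rowGammaIntegrand {α : ℂ} (hα : 0 < α.re) :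
    ∫ y, rowGammaIntegrand p α y ∂(volume.prod volume) = (Real.pi : ℂ) ^ p * Complex.Gamma α := by
  rw [integral_prod _ (integrable_rowGammaIntegrand hα)]
  simp only [integral_rowGammaIntegrand_row]
  rw [integral_indicator measurableSet_Ioi, integral_const_mul, Complex.Gamma_eq_integral hα,
    Complex.GammaIntegral]

lemma cGammaP_succ (α : ℂ) :
    cGammaP (p + 1) α = (Real.pi : ℂ) ^ p * Complex.Gamma α * cGammaP p (α - 1) := by
  have h : (p + 1) * (p + 1 - 1) / 2 = p + p * (p - 1) / 2 := by
    rw [Nat.triangle_succ, add_comm]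
  rw [cGammaP, cGammaP, h, pow_add, Fin.prod_univ_succ]
  simp only [Fin.val_zero, Nat.cast_zero, sub_zero, Fin.val_succ, Nat.cast_succ,
    sub_sub, add_comm (1 : ℂ)]
  ring

lemma integrable_and_integral_hermGammaIntegrand (p : ℕ) : ∀ α : ℂ, (p - 1 : ℝ) < α.re →
    Integrable (hermGammaIntegrand p α) ∧ ∫ T, hermGammaIntegrand p α T = cGammaP p α := by
  induction p with
  | zero =>
    intro α _
    have h1 : hermGammaIntegrand 0 α = fun _ => 1 := by
      ext T
      have : (toHermMatrix 0 T).PosDef := by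
        rw [Subsingleton.elim (toHermMatrix 0 T) 1]
        exact PosDef.one
      simp [hermGammaIntegrand, hermPow_of_posDef this]
    have h2 : (volume : Measure (HermParam 0)) Set.univ = 1 := by
      rw [Measure.volume_eq_prod, ← Set.univ_prod_univ, Measure.prod_prod, volume_pi, volume_pi,
        Measure.pi_univ, Measure.pi_univ]
      simp
    have : IsFiniteMeasure (volume : Measure (HermParam 0)) := ⟨by simp [h2]⟩
    rw [h1]
    refine ⟨integrable_const _, ?_⟩
    simp [cGammaP, Measure.real, h2]
  | succ p ih =>
    intro α hα
    push_cast at hα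
    have hα0 : 0 < α.re := by
      have : (0 : ℝ) ≤ p := p.cast_nonneg
      linarith
    obtain ⟨hint, hval⟩ := ih (α - 1) (by simp; linarith)
    have hmp := measurePreserving_schurGlue (p := p)
    have hmeas := (measurable_hermGammaIntegrand (p := p + 1) α).aestronglyMeasurable
      (μ := volume)
    have hcomp : hermGammaIntegrand (p + 1) α ∘ schurGlue p
        = fun z => rowGammaIntegrand p α z.1 * hermGammaIntegrand p (α - 1) z.2 :=
      funext fun z => hermGammaIntegrand_schurGlue α z
    constructor
    · rw [← hmp.integrable_comp hmeas, hcomp]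
      exact (integrable_rowGammaIntegrand hα0).mul_prod hint
    · have h := integral_map hmp.aemeasurable (hmp.map_eq ▸ hmeas)
      rw [hmp.map_eq] at h
      rw [h]
      simp only [hermGammaIntegrand_schurGlue]
      rw [integral_prod_mul, integral_rowGammaIntegrand hα0, hval, cGammaP_succ]

lemma integrable_hermGammaIntegrand {α : ℂ} (hα : (p - 1 : ℝ) < α.re) :
    Integrable (hermGammaIntegrand p α) :=
  (integrable_and_integral_hermGammaIntegrand p α hα).1

lemma integral_hermGammaIntegrand {α : ℂ} (hα : (p - 1 : ℝ) < α.re) :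
    ∫ T, hermGammaIntegrand p α T = cGammaP p α :=
  (integrable_and_integral_hermGammaIntegrand p α hα).2

end GammaIntegral

section Dirichlet

variable {p : ℕ}

lemma integral_prod_hermGammaIntegrand (k : ℕ) (α : Fin (k + 1) → ℂ) (S : HermParam p) :
    ∫ X : Fin k → HermParam p, (∏ j : Fin k, hermGammaIntegrand p (α j.castSucc) (X j))
        * hermGammaIntegrand p (α (Fin.last k)) (S - ∑ j, X j)
      = hermGammaIntegrand p (∑ j, α j) S
        * dirichletIntegral p k (fun j => α j - p) (hermCoord p 1) := by
  have h1 : ∀ X : Fin k → HermParam p,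
      (∏ j : Fin k, hermGammaIntegrand p (α j.castSucc) (X j))
        * hermGammaIntegrand p (α (Fin.last k)) (S - ∑ j, X j)
      = Complex.exp (-∑ i, (S.1 i : ℂ)) * ((∏ j : Fin k, hermPow p (α j.castSucc - p) (X j))
        * hermPow p (α (Fin.last k) - p) (S - ∑ j, X j)) := by
    intro X
    have h2 : ∑ j, -∑ i, ((X j).1 i : ℂ) = -∑ i, ((∑ j, (X j).1 i : ℝ) : ℂ) := by
      rw [Finset.sum_neg_distrib, Finset.sum_comm]
      push_cast
      rfl
    have h3 : -∑ i, ((S - ∑ j, X j).1 i : ℂ)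
        = -∑ i, (S.1 i : ℂ) - (-∑ i, ((∑ j, (X j).1 i : ℝ) : ℂ)) := by
      simp [Finset.sum_sub_distrib, Prod.fst_sum]
      ring
    simp only [hermGammaIntegrand, Finset.prod_mul_distrib]
    rw [← Complex.exp_sum, h2, h3, Complex.exp_sub]
    field_simp [Complex.exp_ne_zero]
  simp only [h1]
  rw [integral_const_mul]
  have h4 := dirichletIntegral_eq k (fun j => α j - p) S
  have h5 : ∑ j, (α j - p) + k * p = ∑ j, α j - p := by
    simp [Finset.sum_sub_distrib]
    ring
  rw [h5] at h4
  rw [hermGammaIntegrand, mul_right_comm, ← h4, mul_comm]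
  rfl

lemma lt_re_sum (hp : 1 ≤ p) {k : ℕ} {α : Fin (k + 1) → ℂ}
    (hα : ∀ j, (p - 1 : ℝ) < (α j).re) : (p - 1 : ℝ) < (∑ j, α j).re := by
  have hp' : (0 : ℝ) ≤ p - 1 := by
    have : (1 : ℝ) ≤ p := by exact_mod_cast hp
    linarith
  rw [Complex.re_sum, Fin.sum_univ_castSucc]
  have : 0 ≤ ∑ j : Fin k, (α j.castSucc).re :=
    Finset.sum_nonneg fun j _ => hp'.trans (hα _).le
  linarith [hα (Fin.last k)]

lemma cGammaP_mul_dirichletIntegral (hp : 1 ≤ p) (k : ℕ) (α : Fin (k + 1) → ℂ)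
    (hα : ∀ j, (p - 1 : ℝ) < (α j).re) :
    cGammaP p (∑ j, α j) * dirichletIntegral p k (fun j => α j - p) (hermCoord p 1)
      = ∏ j, cGammaP p (α j) := by
  set f : (Fin k → HermParam p) → ℂ :=
    fun X => ∏ j : Fin k, hermGammaIntegrand p (α j.castSucc) (X j) with hf
  set g : HermParam p → ℂ := hermGammaIntegrand p (α (Fin.last k)) with hg
  have hfint : Integrable f := by
    refine Integrable.fintype_prod
      (f := fun j : Fin k => hermGammaIntegrand p (α j.castSucc)) fun j => ?_
    exact integrable_hermGammaIntegrand (hα _)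
  have hfg : Integrable (fun z : (Fin k → HermParam p) × HermParam p => f z.1 * g z.2)
      (volume.prod volume) := hfint.mul_prod (integrable_hermGammaIntegrand (hα _))
  have hshear : MeasurePreserving
      (fun z : (Fin k → HermParam p) × HermParam p => (z.1, z.2 - ∑ j, z.1 j))
      (volume.prod volume) (volume.prod volume) := by
    refine (MeasurePreserving.id _).skew_product
      (g := fun (X : Fin k → HermParam p) S => S - ∑ j, X j) ?_ ?_
    · exact (by fun_prop : Continuous fun z : (Fin k → HermParam p) × HermParam p =>
        z.2 - ∑ j, z.1 j).measurable
    · exact Filter.Eventually.of_forall fun X => map_sub_right_eq_self volume _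
  have h1 : ∫ z : (Fin k → HermParam p) × HermParam p, f z.1 * g (z.2 - ∑ j, z.1 j)
      ∂(volume.prod volume) = ∏ j, cGammaP p (α j) := by
    have h2 := integral_map hshear.aemeasurable (hshear.map_eq ▸ hfg.aestronglyMeasurable)
    rw [hshear.map_eq] at h2
    rw [← h2, integral_prod_mul, Fin.prod_univ_castSucc, hg, integral_hermGammaIntegrand (hα _), hf,
      volume_pi, integral_fintype_prod_eq_prod
        (fun j : Fin k => hermGammaIntegrand p (α j.castSucc))]
    simp only [integral_hermGammaIntegrand (hα _)]
  have h3 : Integrable (fun z : (Fin k → HermParam p) × HermParam p =>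
      f z.1 * g (z.2 - ∑ j, z.1 j)) (volume.prod volume) :=
    (hshear.integrable_comp hfg.aestronglyMeasurable).mpr hfg
  rw [← h1, integral_prod_symm _ h3]
  simp only [hf, hg, integral_prod_hermGammaIntegrand]
  rw [integral_mul_const, integral_hermGammaIntegrand (lt_re_sum hp hα)]

lemma cGammaP_ne_zero {α : ℂ} (hα : (p - 1 : ℝ) < α.re) : cGammaP p α ≠ 0 := by
  refine mul_ne_zero (pow_ne_zero _ (Complex.ofReal_ne_zero.mpr Real.pi_ne_zero)) ?_
  refine Finset.prod_ne_zero_iff.mpr fun j _ => Complex.Gamma_ne_zero_of_re_pos ?_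
  have : (j : ℝ) + 1 ≤ p := by exact_mod_cast j.2
  simp
  linarith

instance (p : ℕ) : BorelSpace (Matrix (Fin p) (Fin p) ℂ) :=
  inferInstanceAs (BorelSpace (Fin p → Fin p → ℂ))

instance (p k : ℕ) : BorelSpace (Fin k → Matrix (Fin p) (Fin p) ℂ) :=
  inferInstanceAs (BorelSpace (Fin k → Fin p → Fin p → ℂ))

lemma measurePreserving_toHermMatrix :
    MeasurePreserving (toHermMatrix p) volume (hermLebesgue p) :=
  ⟨continuous_toHermMatrix.measurable, rfl⟩

lemma injective_toHermMatrix : Function.Injective (toHermMatrix p) :=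
  Function.LeftInverse.injective hermCoord_toHermMatrix

lemma measurableEmbedding_toHermMatrix : MeasurableEmbedding (toHermMatrix p) :=
  (LinearMap.isClosedEmbedding_of_injective (f := hermLin p)
    (LinearMap.ker_eq_bot.mpr injective_toHermMatrix)).measurableEmbedding

lemma measurableEmbedding_toHermMatrix_pi (k : ℕ) :
    MeasurableEmbedding fun (X : Fin k → HermParam p) j => toHermMatrix p (X j) :=
  (LinearMap.isClosedEmbedding_of_injective
    (f := LinearMap.pi fun j : Fin k => hermLin p ∘ₗ LinearMap.proj j)
    (LinearMap.ker_eq_bot.mpr fun _ _ h =>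
      funext fun j => injective_toHermMatrix (congrFun h j))).measurableEmbedding

instance (p : ℕ) : SigmaFinite (hermLebesgue p) :=
  measurableEmbedding_toHermMatrix.sigmaFinite_map

lemma setIntegral_eq_dirichletIntegral (k : ℕ) (α : Fin (k + 1) → ℂ) :
    ∫ X in {X : Fin k → Matrix (Fin p) (Fin p) ℂ |
        (∀ j, (X j).PosDef) ∧ (1 - ∑ j, X j).PosDef},
      ((∏ j : Fin k, ((X j).det.re : ℂ) ^ (α j.castSucc - p)) *
        (((1 - ∑ j, X j).det.re : ℂ) ^ (α (Fin.last k) - p)))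
      ∂(Measure.pi fun _ : Fin k => hermLebesgue p)
    = dirichletIntegral p k (fun j => α j - p) (hermCoord p 1) := by
  have hmp := measurePreserving_pi (fun _ : Fin k => (volume : Measure (HermParam p)))
    (fun _ => hermLebesgue p) fun _ => measurePreserving_toHermMatrix
  rw [← hmp.setIntegral_preimage_emb (measurableEmbedding_toHermMatrix_pi k), ← volume_pi]
  have h1 : ∀ X : Fin k → HermParam p, 1 - ∑ j, toHermMatrix p (X j)
      = toHermMatrix p (hermCoord p 1 - ∑ j, X j) := fun X => by
    rw [toHermMatrix_sub, toHermMatrix_hermCoord isHermitian_one, toHermMatrix_sum]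
  have hset : MeasurableSet {X : Fin k → HermParam p | (∀ j, (toHermMatrix p (X j)).PosDef) ∧
      (toHermMatrix p (hermCoord p 1 - ∑ j, X j)).PosDef} := by
    rw [Set.ofPred_and, Set.ofPred_forall]
    refine MeasurableSet.inter ?_ ?_
    · exact MeasurableSet.iInter fun j => measurableSet_posDef.preimage (measurable_pi_apply j)
    · refine measurableSet_posDef.preimage (Continuous.measurable ?_)
      fun_prop
  simp only [Set.preimage_ofPred_eq, h1]
  rw [← integral_indicator hset, dirichletIntegral]
  congr 1
  ext X
  by_cases hX : (∀ j, (toHermMatrix p (X j)).PosDef) ∧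
      (toHermMatrix p (hermCoord p 1 - ∑ j, X j)).PosDef
  · rw [Set.indicator_of_mem (by exact hX), hermPow_of_posDef hX.2]
    simp only [hermPow_of_posDef (hX.1 _)]
  · rw [Set.indicator_of_notMem (by exact hX)]
    rw [not_and_or, not_forall] at hX
    rcases hX with ⟨j, hj⟩ | hX
    · rw [Finset.prod_eq_zero (Finset.mem_univ j) (hermPow_of_not_posDef hj), zero_mul]
    · rw [hermPow_of_not_posDef hX, mul_zero]

end Dirichlet

theorem stmt8 (p k : ℕ) (hp : 1 ≤ p) (hk : 1 ≤ k) (α : Fin (k + 1) → ℂ)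
    (hα : ∀ j, (p - 1 : ℝ) < (α j).re) :
    ∫ X in {X : Fin k → Matrix (Fin p) (Fin p) ℂ |
        (∀ j, (X j).PosDef) ∧ (1 - ∑ j, X j).PosDef},
      ((∏ j : Fin k, ((X j).det.re : ℂ) ^ (α j.castSucc - p)) *
        (((1 - ∑ j, X j).det.re : ℂ) ^ (α (Fin.last k) - p)))
      ∂(Measure.pi fun _ : Fin k => hermLebesgue p)
    = (∏ j : Fin (k + 1), cGammaP p (α j)) / cGammaP p (∑ j, α j) := by
  rw [setIntegral_eq_dirichletIntegral, eq_div_iff (cGammaP_ne_zero (lt_re_sum hp hα)), mul_comm]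
  exact cGammaP_mul_dirichletIntegral hp k α hα
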